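/- Lag decrease under propagate in Release–Acquire (view-advancement core of the Dist proof rule): Let (M, ν) be a reachable RA state and suppose a propagate transition via message m ∈ M and thread τ leads to the state (M, ν'). Then for every location x, { m' ∈ M : m'.loc = x and m'.ts > ν' τ x } ⊆ { m' ∈ M : m'.loc = x and m'.ts > ν τ x }, and for x = m.loc this inclusion is strict (the message m belongs to the second set but not to the first). In particular, the finite number of messages at location m.loc whose timestamps exceed τ's view strictly decreases. -/

import Mathlib

/-- A message in the Release–Acquire memory model: location, value, timestamp,
writing thread and attached view. -/
structure Message (Loc Tid : Type*) where
  loc : Loc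
  val : ℕ
  ts : ℕ
  tid : Tid
  view : Loc → ℕ

/-- An RA state: a set of messages together with a view per thread. -/
abbrev RAState (Loc Tid : Type*) := Set (Message Loc Tid) × (Tid → Loc → ℕ)

/-- The transitions of the Release–Acquire memory model: read, write,
read-modify-write and propagate. -/
inductive RAStep {Loc Tid : Type*} [DecidableEq Loc] [DecidableEq Tid] :
    RAState Loc Tid → RAState Loc Tid → Prop
  | read (M : Set (Message Loc Tid)) (ν : Tid → Loc → ℕ) (τ : Tid) (x : Loc)
      (m : Message Loc Tid) (hm : m ∈ M) (hloc : m.loc = x)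
      (hts : m.ts = ν τ x) :
      RAStep (M, ν) (M, ν)
  | write (M : Set (Message Loc Tid)) (ν : Tid → Loc → ℕ) (τ : Tid) (x : Loc)
      (v t : ℕ) (hlt : ν τ x < t)
      (hfresh : ∀ m ∈ M, m.loc = x → m.ts ≠ t) :
      RAStep (M, ν)
        (insert ⟨x, v, t, τ, Function.update (ν τ) x t⟩ M,
          Function.update ν τ (Function.update (ν τ) x t))
  | rmw (M : Set (Message Loc Tid)) (ν : Tid → Loc → ℕ) (τ : Tid) (x : Loc)
      (v : ℕ) (mr : Message Loc Tid) (hm : mr ∈ M) (hloc : mr.loc = x)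
      (hts : mr.ts = ν τ x)
      (hfresh : ∀ m ∈ M, m.loc = x → m.ts ≠ ν τ x + 1) :
      RAStep (M, ν)
        (insert ⟨x, v, ν τ x + 1, τ, Function.update (ν τ) x (ν τ x + 1)⟩ M,
          Function.update ν τ (Function.update (ν τ) x (ν τ x + 1)))
  | prop (M : Set (Message Loc Tid)) (ν : Tid → Loc → ℕ) (τ : Tid)
      (m : Message Loc Tid) (hm : m ∈ M) (hlt : ν τ m.loc < m.ts) :
      RAStep (M, ν) (M, Function.update ν τ (fun y => max (ν τ y) (m.view y)))

/-- The initial RA state: one message per location with value 0, timestamp 0,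
written by the initial thread `t0`; all thread views are zero. -/
def RAInit (Loc Tid : Type*) (t0 : Tid) : RAState Loc Tid :=
  ({ m | ∃ x : Loc, m = ⟨x, 0, 0, t0, fun _ => 0⟩ }, fun _ _ => 0)

/-- A state is reachable if it is obtained from the initial state by finitely
many RA transitions. -/
def RAReachable {Loc Tid : Type*} [DecidableEq Loc] [DecidableEq Tid]
    (t0 : Tid) (q : RAState Loc Tid) : Prop :=
  Relation.ReflTransGen RAStep (RAInit Loc Tid t0) q

/-- Every message's view at its own location is its timestamp, and each location carries
finitely many messages. -/
def RAWellFormed {Loc Tid : Type*} (M : Set (Message Loc Tid)) : Prop :=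
  (∀ m ∈ M, m.view m.loc = m.ts) ∧ ∀ x, {m ∈ M | m.loc = x}.Finite

theorem RAWellFormed.insert {Loc Tid : Type*} {M : Set (Message Loc Tid)}
    (h : RAWellFormed M) {m : Message Loc Tid} (hm : m.view m.loc = m.ts) :
    RAWellFormed (insert m M) := by
  refine ⟨fun m' hm' => ?_, fun x => ?_⟩
  · rcases hm' with rfl | hm'
    · exact hm
    · exact h.1 m' hm'
  · refine ((h.2 x).insert m).subset ?_
    rintro m' ⟨rfl | hm', hx⟩
    · exact Or.inl rfl
    · exact Or.inr ⟨hm', hx⟩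

theorem RAWellFormed.init (Loc : Type*) {Tid : Type*} (t0 : Tid) :
    RAWellFormed (RAInit Loc Tid t0).1 := by
  refine ⟨?_, fun x => (Set.finite_singleton (⟨x, 0, 0, t0, fun _ => 0⟩ : Message Loc Tid)).subset ?_⟩
  · rintro _ ⟨x, rfl⟩
    rfl
  · rintro _ ⟨⟨y, rfl⟩, rfl⟩
    rfl

theorem RAWellFormed.step {Loc Tid : Type*} [DecidableEq Loc] [DecidableEq Tid]
    {p q : RAState Loc Tid} (hs : RAStep p q) (h : RAWellFormed p.1) : RAWellFormed q.1 := by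
  cases hs with
  | read => exact h
  | write => exact h.insert (by simp)
  | rmw => exact h.insert (by simp)
  | prop => exact h

theorem RAReachable.wellFormed {Loc Tid : Type*} [DecidableEq Loc] [DecidableEq Tid]
    {t0 : Tid} {q : RAState Loc Tid} (h : RAReachable t0 q) : RAWellFormed q.1 := by
  induction h with
  | refl => exact RAWellFormed.init Loc t0
  | tail _ hs ih => exact RAWellFormed.step hs ih

/-- Lag decrease under propagate in Release–Acquire: after a propagate step via
message `m` and thread `τ` from a reachable state, at every location the set of
messages with timestamps above `τ`'s view shrinks, strictly so at `m.loc`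
(message `m` leaves the set); in particular the number of messages at `m.loc`
above `τ`'s view strictly decreases. -/
theorem RA_propagate_lag_decrease {Loc Tid : Type*} [DecidableEq Loc] [DecidableEq Tid]
    (t0 : Tid) (M : Set (Message Loc Tid)) (ν : Tid → Loc → ℕ)
    (hreach : RAReachable t0 (M, ν))
    (m : Message Loc Tid) (τ : Tid) (hm : m ∈ M) (hlt : ν τ m.loc < m.ts)
    (ν' : Tid → Loc → ℕ)
    (hν' : ν' = Function.update ν τ (fun y => max (ν τ y) (m.view y))) :
    (∀ x : Loc,
      { m' ∈ M | m'.loc = x ∧ ν' τ x < m'.ts } ⊆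
        { m' ∈ M | m'.loc = x ∧ ν τ x < m'.ts }) ∧
    m ∈ { m' ∈ M | m'.loc = m.loc ∧ ν τ m.loc < m'.ts } ∧
    m ∉ { m' ∈ M | m'.loc = m.loc ∧ ν' τ m.loc < m'.ts } ∧
    { m' ∈ M | m'.loc = m.loc ∧ ν' τ m.loc < m'.ts }.ncard <
      { m' ∈ M | m'.loc = m.loc ∧ ν τ m.loc < m'.ts }.ncard := by
  obtain ⟨hview, hfin⟩ := hreach.wellFormed
  subst hν'
  have hsub : ∀ x : Loc,
      { m' ∈ M | m'.loc = x ∧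
          Function.update ν τ (fun y => max (ν τ y) (m.view y)) τ x < m'.ts } ⊆
        { m' ∈ M | m'.loc = x ∧ ν τ x < m'.ts } := by
    rintro x m' ⟨hm', hx, hlt'⟩
    rw [Function.update_self] at hlt'
    exact ⟨hm', hx, (le_max_left _ _).trans_lt hlt'⟩
  have hmem : m ∈ { m' ∈ M | m'.loc = m.loc ∧ ν τ m.loc < m'.ts } := ⟨hm, rfl, hlt⟩
  have hnot : m ∉ { m' ∈ M | m'.loc = m.loc ∧
      Function.update ν τ (fun y => max (ν τ y) (m.view y)) τ m.loc < m'.ts } := by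
    rintro ⟨-, -, hlt'⟩
    rw [Function.update_self] at hlt'
    exact ((le_max_right _ _).trans_lt hlt').ne (hview m hm)
  refine ⟨hsub, hmem, hnot, Set.ncard_lt_ncard ?_ ?_⟩
  · exact (Set.ssubset_iff_of_subset (hsub _)).2 ⟨m, hmem, hnot⟩
  · exact (hfin m.loc).subset fun m' h => ⟨h.1, h.2.1⟩
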